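/- arXiv:1810.10885 — 2 statements merged into one kernel-verified Lean document; each statement's English description precedes it below -/
import Mathlib

section
/- Let p be a prime and n ≥ 2 an integer. Let A be a nonzero Artinian local commutative ring in which p ≠ 0 and whose residue field κ is a perfect field of characteristic p. Then there is no natural family (F_B) of group homomorphisms F_B : GL_n(B) → GL_n(B), indexed by commutative A-algebras B, such that for every commutative A-algebra B on which the structure map kills the maximal ideal of A (i.e. B is a κ-algebra), the map F_B is the entrywise Frobenius. In other words, the Frobenius homomorphism of GL_n admits no deformation over any such A (functor-of-points form of the theorem that the Frobenius homomorphism of a reductive group of positive rank deforms only over rings where p = 0). -/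
universe u

open Matrix

namespace FrobDef

open Polynomial

/-- Elementary transvection as an element of `GL_n`. -/
def tv {n : ℕ} {R : Type*} [CommRing R] (i j : Fin n) (h : i ≠ j) (c : R) :
    GeneralLinearGroup (Fin n) R :=
  ⟨transvection i j c, transvection i j (-c),
    by rw [transvection_mul_transvection_same i j h]; simp,
    by rw [transvection_mul_transvection_same i j h]; simp⟩

/-- Diagonal matrix with `t` at position `i` and `1` elsewhere. -/
def dg {n : ℕ} {R : Type*} [CommRing R] (i : Fin n) (t : Rˣ) :
    GeneralLinearGroup (Fin n) R :=
  ⟨diagonal fun k => if k = i then (t : R) else 1,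
   diagonal fun k => if k = i then ((t⁻¹ : Rˣ) : R) else 1,
    by
      rw [diagonal_mul_diagonal, ← diagonal_one]
      congr 1; funext k; split_ifs <;> simp,
    by
      rw [diagonal_mul_diagonal, ← diagonal_one]
      congr 1; funext k; split_ifs <;> simp⟩

lemma tv_add {n : ℕ} {R : Type*} [CommRing R] (i j : Fin n) (h : i ≠ j) (c d : R) :
    tv i j h (c + d) = tv i j h c * tv i j h d := by
  apply Units.ext
  simp [tv, transvection_mul_transvection_same i j h]

lemma map_tv {n : ℕ} {R S : Type*} [CommRing R] [CommRing S] (f : R →+* S)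
    (i j : Fin n) (h : i ≠ j) (c : R) :
    GeneralLinearGroup.map f (tv i j h c) = tv i j h (f c) := by
  apply Units.ext
  ext a b
  simp [tv, transvection, Matrix.one_apply, Matrix.single_apply]
  split_ifs <;> simp

lemma map_dg {n : ℕ} {R S : Type*} [CommRing R] [CommRing S] (f : R →+* S)
    (i : Fin n) (t : Rˣ) :
    GeneralLinearGroup.map f (dg i t) = dg i (Units.map (f : R →* S) t) := by
  apply Units.ext
  ext a b
  simp [dg, Matrix.diagonal_apply]
  split_ifs <;> simp

lemma dg_mul_tv {n : ℕ} {R : Type*} [CommRing R] (i j : Fin n) (h : i ≠ j) (t : Rˣ) (c : R) :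
    dg i t * tv i j h c = tv i j h (t * c) * dg i t := by
  apply Units.ext
  ext a b
  simp only [dg, tv, transvection, Units.val_mul, Matrix.single_apply, Matrix.add_apply,
    Matrix.one_apply, Matrix.diagonal_mul, Matrix.mul_diagonal]
  have h' := h.symm
  by_cases ha : a = i <;> by_cases hb : b = j
  · subst ha hb; simp [h, h']
  · subst ha; by_cases hab : a = b
    · subst hab; simp [h']
    · simp [hab, Ne.symm hb]
  · subst hb; by_cases hab : a = b
    · subst hab; simp [ha, h]
    · simp [hab, ha, Ne.symm ha, h']
  · by_cases hab : a = b
    · subst hab; simp [ha, Ne.symm ha]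
    · simp [hab, Ne.symm ha, Ne.symm hb]

lemma coeff_aeval_mul_X {A L : Type*} [CommRing A] [CommRing L] [Algebra A L] (t : L) (q : A[X])
    (k : ℕ) :
    (aeval (C t * X : L[X]) q).coeff k = algebraMap A L (q.coeff k) * t ^ k := by
  have : aeval (C t * X : L[X]) q = (q.map (algebraMap A L)).comp (C t * X) := by
    rw [Polynomial.comp, Polynomial.eval₂_map, aeval_def]
    rfl
  rw [this, Polynomial.comp_C_mul_X_coeff, coeff_map]

lemma coeff_aeval_X' {A L : Type*} [CommRing A] [CommRing L] [Algebra A L] (q : A[X]) (k : ℕ) :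
    (aeval (X : L[X]) q).coeff k = algebraMap A L (q.coeff k) := by
  have := coeff_aeval_mul_X (1 : L) q k
  simpa using this

lemma laurent_coeff_left {A : Type*} [CommRing A] (f : LaurentPolynomial A) (a : A) (k : ℤ) :
    (f * algebraMap A (LaurentPolynomial A) a).coeff k = f.coeff k * a := by
  rw [mul_comm, ← Algebra.smul_def]
  simp
  exact mul_comm _ _

lemma laurent_coeff_right {A : Type*} [CommRing A] (f : LaurentPolynomial A) (a : A) (k : ℤ) :
    (algebraMap A (LaurentPolynomial A) a * LaurentPolynomial.T 1 * f).coeff (k + 1)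
      = a * f.coeff k := by
  rw [mul_assoc, ← Algebra.smul_def, LaurentPolynomial.T_mul]
  have : (f * LaurentPolynomial.T 1).coeff (k + 1) = f.coeff k := by
    have := AddMonoidAlgebra.coeff_mul_single_add f (1 : A) 1 k
    rw [mul_one] at this
    exact this
  simp [this]

lemma laurent_coeff_map {A K : Type*} [CommRing A] [CommRing K] [Algebra A K]
    (f : LaurentPolynomial A) (k : ℤ) :
    (AddMonoidAlgebra.mapAlgHom ℤ (Algebra.ofId A K) f).coeff k = algebraMap A K (f.coeff k) := by
  simp [Algebra.ofId_apply]

lemma laurent_coeff_sum {A : Type*} [CommRing A] {n : ℕ} (g : Fin n → LaurentPolynomial A)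
    (k : ℤ) : (∑ x, g x).coeff k = ∑ x, (g x).coeff k := by
  have : (∑ x, g x).coeff = ∑ x, (g x).coeff :=
    map_sum (AddMonoidAlgebra.coeffAddEquiv (R := A) (M := ℤ)) g Finset.univ
  rw [this, Finsupp.finsetSum_apply]

lemma dual_zero {R : Type*} [CommRing R] (q : R)
    (h : algebraMap R (DualNumber R) q * DualNumber.eps = 0) : q = 0 := by
  have h5 := congrArg TrivSqZeroExt.snd h
  rw [TrivSqZeroExt.algebraMap_eq_inl, TrivSqZeroExt.snd_mul] at h5
  simpa using h5

/-- Key linear algebra: the derivative of the family along a root subgroup vanishes. -/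
lemma nil_step {n : ℕ} {A : Type*} [CommRing A] (m I : Ideal A)
    (c E0 Ep E1 Eq : Matrix (Fin n) (Fin n) A)
    (h0 : c * E0 = E1 * c) (hp : c * Ep = Eq * c)
    (h1 : ∀ i j, E1 i j ∈ m) (hq : ∀ i j, Eq i j ∈ m)
    (hs : ∀ i j, (1 - E0 - Ep) i j ∈ m) (hc : ∀ i j, c i j ∈ I) :
    ∀ i j, c i j ∈ m * I := by
  intro i j
  have e : c = c * (1 - E0 - Ep) + E1 * c + Eq * c := by
    rw [← h0, ← hp]; noncomm_ring
  rw [e]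
  simp only [Matrix.add_apply, Matrix.mul_apply]
  refine add_mem (add_mem ?_ ?_) ?_
  · refine sum_mem fun k _ => ?_
    rw [mul_comm (c i k)]
    exact Ideal.mul_mem_mul (hs _ _) (hc _ _)
  · exact sum_mem fun k _ => Ideal.mul_mem_mul (h1 _ _) (hc _ _)
  · exact sum_mem fun k _ => Ideal.mul_mem_mul (hq _ _) (hc _ _)

end FrobDef

/-- Let `p` be a prime and `n ≥ 2`.  Let `A` be a nonzero Artinian local commutative ring with
`p ≠ 0` in `A`, whose residue field `κ` is a perfect field of characteristic `p`.  Then there is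
no natural family of group homomorphisms `F_B : GL_n(B) → GL_n(B)`, indexed by commutative
`A`-algebras `B`, restricting to the entrywise Frobenius on every `κ`-algebra `B` (i.e. every
`B` on which the structure map kills the maximal ideal of `A`): the Frobenius homomorphism of
`GL_n` admits no deformation over `A`. -/
theorem no_deformation_of_frobenius_GL
    (p n : ℕ) [Fact p.Prime] (hn : 2 ≤ n)
    (A : Type u) [CommRing A] [IsArtinianRing A] [IsLocalRing A] [Nontrivial A]
    (hpA : (p : A) ≠ 0)
    [CharP (IsLocalRing.ResidueField A) p]
    [PerfectField (IsLocalRing.ResidueField A)] :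
    ¬ ∃ F : ∀ (B : Type u) [CommRing B] [Algebra A B],
        GeneralLinearGroup (Fin n) B →* GeneralLinearGroup (Fin n) B,
      (∀ (B B' : Type u) [CommRing B] [CommRing B'] [Algebra A B] [Algebra A B']
          (f : B →ₐ[A] B') (M : GeneralLinearGroup (Fin n) B),
          F B' (GeneralLinearGroup.map (f : B →+* B') M)
            = GeneralLinearGroup.map (f : B →+* B') (F B M)) ∧
      (∀ (B : Type u) [CommRing B] [Algebra A B],
          (∀ a ∈ IsLocalRing.maximalIdeal A, algebraMap A B a = 0) →
          ∀ (M : GeneralLinearGroup (Fin n) B) (i j : Fin n),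
            (F B M : Matrix (Fin n) (Fin n) B) i j
              = ((M : Matrix (Fin n) (Fin n) B) i j) ^ p) := by
  rintro ⟨F, hnat, hfrob⟩
  have hpp : p.Prime := Fact.out
  obtain ⟨i, j, hij⟩ : ∃ i j : Fin n, i ≠ j :=
    ⟨⟨0, by omega⟩, ⟨1, by omega⟩, by simp [Fin.ext_iff]⟩
  let κ := IsLocalRing.ResidueField A
  let m := IsLocalRing.maximalIdeal A
  have hker : ∀ a ∈ m, algebraMap A κ a = 0 := fun a ha =>
    (IsLocalRing.residue_eq_zero_iff a).2 ha
  have hmem : ∀ a, algebraMap A κ a = 0 → a ∈ m := fun a ha =>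
    (IsLocalRing.residue_eq_zero_iff a).1 ha
  -- the root subgroup
  let c : GeneralLinearGroup (Fin n) (Polynomial A) :=
    F (Polynomial A) (FrobDef.tv i j hij Polynomial.X)
  have hc : ∀ (B : Type u) [CommRing B] [Algebra A B] (b : B) (k l : Fin n),
      (F B (FrobDef.tv i j hij b)).1 k l = Polynomial.aeval b (c.1 k l) := by
    intro B _ _ b k l
    have := hnat (Polynomial A) B (Polynomial.aeval b) (FrobDef.tv i j hij Polynomial.X)
    rw [FrobDef.map_tv] at this
    simp only [RingHom.coe_coe, Polynomial.aeval_X] at this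
    rw [this]
    rfl
  -- the torus
  let L := LaurentPolynomial A
  let t : Lˣ := ⟨LaurentPolynomial.T 1, LaurentPolynomial.T (-1),
    by rw [← LaurentPolynomial.T_add]; simp, by rw [← LaurentPolynomial.T_add]; simp⟩
  let φ : GeneralLinearGroup (Fin n) L := F L (FrobDef.dg i t)
  let E : ℤ → Matrix (Fin n) (Fin n) A := fun k => Matrix.of fun a b => (φ.1 a b).coeff k
  let D : Matrix (Fin n) (Fin n) A := Matrix.of fun a b => (c.1 a b).coeff 1
  -- the torus modulo the maximal ideal
  have hE : ∀ (k : ℤ) (a b : Fin n), algebraMap A κ (E k a b) =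
      if a = b then (if a = i then (if k = p then 1 else 0) else (if k = 0 then 1 else 0)) else 0 := by
    intro k a b
    let f : L →ₐ[A] LaurentPolynomial κ := AddMonoidAlgebra.mapAlgHom ℤ (Algebra.ofId A κ)
    have h1 := hnat L (LaurentPolynomial κ) f (FrobDef.dg i t)
    have h2 := hfrob (LaurentPolynomial κ) (fun a ha => by
      rw [IsScalarTower.algebraMap_apply A κ (LaurentPolynomial κ)]
      rw [hker a ha, map_zero]) (GeneralLinearGroup.map (f : L →+* _) (FrobDef.dg i t)) a b
    rw [h1] at h2
    have h3 : f (φ.1 a b) = (f ((FrobDef.dg i t).1 a b)) ^ p := h2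
    have h4 : (f (φ.1 a b)).coeff k = algebraMap A κ (E k a b) := by
      exact FrobDef.laurent_coeff_map _ _
    rw [← h4, h3, ← map_pow]
    have h5 : ((FrobDef.dg i t).1 a b) ^ p = if a = b then
        (if a = i then LaurentPolynomial.T p else LaurentPolynomial.T 0) else 0 := by
      simp only [FrobDef.dg, Matrix.diagonal_apply, t]
      split_ifs
      · rw [LaurentPolynomial.T_pow]; simp
      · simp
      · simp [hpp.ne_zero]
    rw [h5]
    have h6 := FrobDef.laurent_coeff_map (K := κ) (if a = b then
        (if a = i then LaurentPolynomial.T p else LaurentPolynomial.T 0) else 0 :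
          LaurentPolynomial A) k
    refine Eq.trans h6 ?_
    clear h6 h5 h4 h3 h2 h1
    split_ifs with q1 q2 q3 q3
    · subst q3; simp [LaurentPolynomial.T_apply]
    · simp [LaurentPolynomial.T_apply, Ne.symm q3]
    · subst q3; simp
    · rw [LaurentPolynomial.T_apply, if_neg (Ne.symm q3), map_zero]
    · simp
  -- the commutation relation
  have hrel : ∀ k : ℤ, E (k + 1) * D = D * E k := by
    intro k
    ext a b
    let t' : (Polynomial L)ˣ := Units.map (Polynomial.C : L →+* Polynomial L) t
    have h1 : F (Polynomial L) (FrobDef.dg i t') =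
        GeneralLinearGroup.map ((IsScalarTower.toAlgHom A L (Polynomial L) :
          L →ₐ[A] Polynomial L) : L →+* Polynomial L) φ := by
      rw [← hnat, FrobDef.map_dg]
      rfl
    have h2 := congrArg (F (Polynomial L)) (FrobDef.dg_mul_tv i j hij t' Polynomial.X)
    rw [map_mul, map_mul, h1] at h2
    have h3 := congrArg (fun M : GeneralLinearGroup (Fin n) (Polynomial L) =>
      ((M.1 a b).coeff 1).coeff (k + 1)) h2
    simp only [Units.val_mul, Matrix.mul_apply, hc] at h3
    have h4 : ∀ x y, (GeneralLinearGroup.map ((IsScalarTower.toAlgHom A L (Polynomial L) :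
          L →ₐ[A] Polynomial L) : L →+* Polynomial L) φ).1 x y = Polynomial.C (φ.1 x y) :=
      fun x y => rfl
    have h5 : (t' : Polynomial L) * Polynomial.X =
        Polynomial.C (LaurentPolynomial.T 1 : L) * Polynomial.X := rfl
    simp only [h4, h5, Polynomial.finsetSum_coeff, Polynomial.coeff_C_mul,
      Polynomial.coeff_mul_C, FrobDef.coeff_aeval_X', FrobDef.coeff_aeval_mul_X, pow_one] at h3
    have h7 : ∀ g : Fin n → L, (∑ x, g x).coeff (k + 1) = ∑ x, (g x).coeff (k + 1) := by
      intro g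
      exact FrobDef.laurent_coeff_sum g _
    rw [h7, h7] at h3
    simp only [L, FrobDef.laurent_coeff_left, FrobDef.laurent_coeff_right] at h3
    simp only [Matrix.mul_apply]
    exact h3
  have hD : ∀ r : ℕ, ∀ a b, D a b ∈ m ^ r := by
    intro r
    induction r with
    | zero => simp
    | succ r ih =>
      rw [pow_succ']
      refine FrobDef.nil_step m (m ^ r) D (E 0) (E p) (E 1) (E (p + 1))
        (hrel 0).symm (hrel p).symm ?_ ?_ ?_ ih
      · intro a b
        apply hmem
        rw [hE]
        have := hpp.one_lt
        split_ifs <;> first | rfl | omega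
      · intro a b
        apply hmem
        rw [hE]
        split_ifs <;> first | rfl | omega
      · intro a b
        apply hmem
        have := hpp.ne_zero
        simp only [Matrix.sub_apply, map_sub, hE, Matrix.one_apply]
        split_ifs <;> first | omega | simp
  have hD0 : ∀ a b, D a b = 0 := by
    intro a b
    obtain ⟨N, hN⟩ := IsArtinianRing.isNilpotent_jacobson_bot (R := A)
    rw [IsLocalRing.jacobson_eq_maximalIdeal _ bot_ne_top] at hN
    have := hD N a b
    change _ ∈ IsLocalRing.maximalIdeal A ^ N at this
    rw [hN] at this
    simpa using this
  -- constant term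
  have hc0 : ∀ a b, (c.1 a b).coeff 0 = (1 : Matrix (Fin n) (Fin n) A) a b := by
    intro a b
    have h := hc A 0 a b
    have h0 : FrobDef.tv i j hij (0 : A) = 1 := by
      apply Units.ext; simp [FrobDef.tv]
    rw [h0, map_one] at h
    rw [Polynomial.coeff_zero_eq_aeval_zero, ← h]
    rfl
  -- derivative
  have hder : Polynomial.derivative (c.1 i j) = 0 := by
    let B := DualNumber (Polynomial A)
    let x : B := algebraMap (Polynomial A) B Polynomial.X
    let e : B := DualNumber.eps
    have he : e ^ 2 = 0 := by rw [pow_two]; exact DualNumber.eps_mul_eps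
    have h1 := congrArg (F B) (FrobDef.tv_add i j hij x e)
    have h2 : F B (FrobDef.tv i j hij e) = 1 := by
      apply Units.ext
      refine Matrix.ext fun a b => ?_
      rw [hc, ← zero_add e, Polynomial.aeval_add_of_sq_eq_zero _ _ _ he]
      rw [← Polynomial.coeff_zero_eq_aeval_zero', ← Polynomial.coeff_zero_eq_aeval_zero', Polynomial.coeff_derivative, hc0]
      have : (c.1 a b).coeff (0 + 1) = 0 := hD0 a b
      rw [this]
      simp [Matrix.one_apply]
    rw [map_mul, h2, mul_one] at h1
    have h3 := congrArg (fun M => M.1 i j) h1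
    simp only [hc] at h3
    rw [Polynomial.aeval_add_of_sq_eq_zero _ _ _ he, add_eq_left] at h3
    have h4 : ∀ q : Polynomial A, Polynomial.aeval x q = algebraMap (Polynomial A) B q := by
      intro q
      rw [Polynomial.aeval_algebraMap_apply]
      simp
    rw [h4] at h3
    exact FrobDef.dual_zero _ h3
  have hcp : algebraMap A κ ((c.1 i j).coeff p) = 1 := by
    have h := hfrob (Polynomial κ) (fun a ha => by
      rw [IsScalarTower.algebraMap_apply A κ (Polynomial κ)]
      rw [hker a ha, map_zero]) (FrobDef.tv i j hij Polynomial.X) i j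
    rw [hc] at h
    have h6 : (Polynomial.X : Polynomial κ) = Polynomial.C (1 : κ) * Polynomial.X := by simp
    have h7 := congrArg (fun q => Polynomial.coeff q p) h
    rw [h6] at h7
    simp only [FrobDef.coeff_aeval_mul_X] at h7
    simpa [FrobDef.tv, transvection, Matrix.one_apply, hij] using h7
  have hu : IsUnit ((c.1 i j).coeff p) := by
    by_contra hnu
    have := hker _ ((IsLocalRing.mem_maximalIdeal _).2 hnu)
    rw [this] at hcp
    exact zero_ne_one hcp
  apply hpA
  have h := congrArg (fun q => Polynomial.coeff q (p - 1)) hder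
  simp only [Polynomial.coeff_derivative, Polynomial.coeff_zero] at h
  rw [Nat.sub_add_cancel hpp.one_le, hu.mul_right_eq_zero] at h
  rw [← h, ← Nat.cast_succ, Nat.succ_eq_add_one, Nat.sub_add_cancel hpp.one_le]
end

section
/- Let p be a prime and n ≥ 2 an integer. Let A be a nonzero Artinian local commutative ring in which p ≠ 0 and whose residue field κ is a perfect field of characteristic p. Then there is no natural family (F_B) of group homomorphisms F_B : SL_n(B) → SL_n(B), indexed by commutative A-algebras B, such that for every commutative A-algebra B on which the structure map kills the maximal ideal of A (i.e. B is a κ-algebra), the map F_B is the entrywise Frobenius. In other words, the Frobenius homomorphism of SL_n admits no deformation over any such A. -/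
universe u

open Matrix

section FrobHelpers
open Polynomial

/-- The diagonal element of `SL_n`. -/
def frobDiag {n : ℕ} {B : Type*} [CommRing B] (d : Fin n → B) (h : ∏ i, d i = 1) :
    SpecialLinearGroup (Fin n) B := ⟨Matrix.diagonal d, by rw [Matrix.det_diagonal, h]⟩

/-- The elementary element of `SL_n`. -/
def frobElem {n : ℕ} {B : Type*} [CommRing B] (i j : Fin n) (h : i ≠ j) (x : B) :
    SpecialLinearGroup (Fin n) B := ⟨Matrix.transvection i j x, Matrix.det_transvection_of_ne i j h x⟩

/-- The weights. -/
def frobW {n : ℕ} (i0 : Fin n) (i : Fin n) : ℤ := if i = i0 then (n : ℤ) - 1 else -1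

lemma frobW_sum {n : ℕ} (i0 : Fin n) : ∑ i, frobW i0 i = 0 := by
  have : ∀ i, frobW i0 i = (if i = i0 then (n : ℤ) else 0) - 1 := by
    intro i; unfold frobW; split_ifs <;> ring
  simp [this]

lemma frob_prod_single {n : ℕ} {A G : Type*} [CommRing A] [AddCommGroup G] (i0 : Fin n) (g : G) :
    ∏ i, (AddMonoidAlgebra.single (frobW i0 i • g) (1 : A)) = 1 := by
  have : ∀ s : Finset (Fin n), ∏ i ∈ s, (AddMonoidAlgebra.single (frobW i0 i • g) (1 : A))
      = AddMonoidAlgebra.single ((∑ i ∈ s, frobW i0 i) • g) 1 := by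
    intro s
    induction s using Finset.induction_on with
    | empty => simp [AddMonoidAlgebra.one_def]
    | insert a s ha ih =>
      rw [Finset.prod_insert ha, Finset.sum_insert ha, ih, AddMonoidAlgebra.single_mul_single,
        add_smul, one_mul]
  rw [this, frobW_sum, zero_smul, AddMonoidAlgebra.one_def]

lemma frob_coeff_inl_inr {A : Type*} [CommRing A] (f g : AddMonoidAlgebra A ℤ) (k l : ℤ) :
    (AddMonoidAlgebra.mapDomainAlgHom A A (AddMonoidHom.inl ℤ ℤ) f *
      AddMonoidAlgebra.mapDomainAlgHom A A (AddMonoidHom.inr ℤ ℤ) g).coeff (k, l)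
      = f.coeff k * g.coeff l := by
  induction f using AddMonoidAlgebra.induction_linear with
  | zero => simp
  | add x y hx hy => simp only [map_add, add_mul, AddMonoidAlgebra.coeff_add, Finsupp.add_apply, hx, hy]
  | single m r =>
    induction g using AddMonoidAlgebra.induction_linear with
    | zero => simp
    | add x y hx hy => simp only [map_add, mul_add, AddMonoidAlgebra.coeff_add, Finsupp.add_apply, hx, hy]
    | single m' r' =>
      simp only [AddMonoidAlgebra.mapDomainAlgHom_apply, AddMonoidAlgebra.mapDomain_single,
        AddMonoidAlgebra.single_mul_single, AddMonoidAlgebra.coeff_single, Finsupp.single_apply,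
        AddMonoidHom.inl_apply, AddMonoidHom.inr_apply, Prod.mk_add_mk, add_zero, zero_add,
        Prod.mk.injEq]
      split_ifs <;> simp_all

lemma frob_coeff_diag {A : Type*} [CommRing A] (f : AddMonoidAlgebra A ℤ) (k : ℤ) :
    (AddMonoidAlgebra.mapDomainAlgHom A A
      ((AddMonoidHom.id ℤ).prod (AddMonoidHom.id ℤ)) f).coeff (k, k) = f.coeff k := by
  induction f using AddMonoidAlgebra.induction_linear with
  | zero => simp
  | add x y hx hy => simp only [map_add, AddMonoidAlgebra.coeff_add, Finsupp.add_apply, hx, hy]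
  | single m r => simp [Finsupp.single_apply, -LaurentPolynomial.single_eq_C_mul_T]

lemma frob_coeff_scale {A R : Type*} [CommRing A] [CommRing R] [Algebra A R] (f : A[X]) (a : R) (q : ℕ) :
    (aeval (C a * X : R[X]) f).coeff q = algebraMap A R (f.coeff q) * a ^ q := by
  have : aeval (C a * X : R[X]) f = (f.map (algebraMap A R)).comp (C a * X) := by
    rw [Polynomial.comp, eval₂_map, aeval_def]; rfl
  rw [this, comp_C_mul_X_coeff, coeff_map]

lemma frob_coeff_add {A : Type*} [CommRing A] (f : A[X]) (q r : ℕ) :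
    ((aeval (X + C X : A[X][X]) f).coeff q).coeff r = (Nat.choose (q + r) q : A) * f.coeff (q + r) := by
  induction f using Polynomial.induction_on' with
  | add x y hx hy => simp only [map_add, coeff_add, hx, hy, mul_add]
  | monomial m a =>
    rw [aeval_monomial, ← Algebra.smul_def, coeff_smul, coeff_smul, coeff_X_add_C_pow,
      ← C_eq_natCast, coeff_mul_C, coeff_X_pow, coeff_monomial, smul_eq_mul]
    by_cases h : q ≤ m
    · by_cases h' : m = q + r
      · subst h'; simp [mul_comm]
      · rw [if_neg h', if_neg (by omega)]; simp
    · rw [Nat.choose_eq_zero_of_lt (by omega), if_neg (show m ≠ q + r by omega)]; simp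

lemma frob_idem {n : ℕ} {A : Type*} [CommRing A] [IsArtinianRing A] [IsLocalRing A]
    (P : Matrix (Fin n) (Fin n) A) (h : P * P = P)
    (hm : ∀ i j, P i j ∈ IsLocalRing.maximalIdeal A) : P = 0 := by
  have key : ∀ k : ℕ, ∀ i j, P i j ∈ IsLocalRing.maximalIdeal A ^ k := by
    intro k
    induction k with
    | zero => simp
    | succ k ih =>
      intro i j
      rw [← h, Matrix.mul_apply, pow_succ]
      exact Ideal.sum_mem _ fun m _ => Ideal.mul_mem_mul (ih i m) (hm m j)
  obtain ⟨N, hN⟩ := IsArtinianRing.isNilpotent_jacobson_bot (R := A)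
  rw [IsLocalRing.jacobson_eq_maximalIdeal ⊥ bot_ne_top] at hN
  ext i j
  have := key N i j
  rw [hN] at this
  simpa using this

end FrobHelpers


section FrobMain
open Polynomial

variable {n : ℕ} {A : Type u} [CommRing A]

lemma frob_mul_val {B : Type*} [CommRing B] (M N : SpecialLinearGroup (Fin n) B) :
    (M * N).1 = M.1 * N.1 := rfl

lemma frob_mul_apply {B : Type*} [CommRing B] (M N : SpecialLinearGroup (Fin n) B) (i j : Fin n) :
    (M * N).1 i j = ∑ m, M.1 i m * N.1 m j := by
  rw [frob_mul_val, Matrix.mul_apply]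

/-- The one-parameter subgroup. -/
noncomputable def frobTau (i0 : Fin n) {A' G : Type*} [CommRing A'] [AddCommGroup G] (g : G) :
    SpecialLinearGroup (Fin n) (AddMonoidAlgebra A' G) :=
  frobDiag (fun i => AddMonoidAlgebra.single (frobW i0 i • g) 1) (frob_prod_single i0 g)

lemma frobTau_apply (i0 : Fin n) {A' G : Type*} [CommRing A'] [AddCommGroup G] (g : G)
    (i j : Fin n) : (frobTau (A' := A') i0 g).1 i j
      = if i = j then AddMonoidAlgebra.single (frobW i0 i • g) 1 else 0 := by
  simp only [frobTau, frobDiag, Matrix.diagonal_apply]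

lemma frobElem_apply {B : Type*} [CommRing B] (i0 i1 : Fin n) (h : i0 ≠ i1) (x : B)
    (i j : Fin n) : (frobElem i0 i1 h x).1 i j
      = (if i = j then 1 else 0) + (if i0 = i ∧ i1 = j then x else 0) := by
  simp [frobElem, Matrix.transvection, Matrix.one_apply, Matrix.single_apply]

lemma frobTau_mul (i0 : Fin n) {A' G : Type*} [CommRing A'] [AddCommGroup G] (g h : G) :
    frobTau (A' := A') i0 g * frobTau i0 h = frobTau i0 (g + h) := by
  apply Subtype.ext
  rw [frob_mul_val]
  simp only [frobTau, frobDiag, Matrix.diagonal_mul_diagonal,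
    AddMonoidAlgebra.single_mul_single, smul_add, mul_one]

lemma frobElem_mul {B : Type*} [CommRing B] (i0 i1 : Fin n) (h : i0 ≠ i1) (x y : B) :
    frobElem i0 i1 h x * frobElem i0 i1 h y = frobElem i0 i1 h (x + y) := by
  apply Subtype.ext
  rw [frob_mul_val]
  simp only [frobElem, Matrix.transvection_mul_transvection_same _ _ h]

variable (F : ∀ (B : Type u) [CommRing B] [Algebra A B],
        SpecialLinearGroup (Fin n) B →* SpecialLinearGroup (Fin n) B)

/-- Naturality on entries. -/
def FrobNat : Prop := ∀ (B B' : Type u) [CommRing B] [CommRing B'] [Algebra A B] [Algebra A B']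
      (f : B →ₐ[A] B') (M : SpecialLinearGroup (Fin n) B) (M' : SpecialLinearGroup (Fin n) B'),
      (∀ i j, f (M.1 i j) = M'.1 i j) → ∀ i j, (F B' M').1 i j = f ((F B M).1 i j)

/-- Coefficient matrices on the torus. -/
noncomputable def frobP (i0 : Fin n) (k : ℤ) : Matrix (Fin n) (Fin n) A :=
  Matrix.of fun i j => ((F (AddMonoidAlgebra A ℤ) (frobTau i0 1)).1 i j).coeff k

/-- Coefficient matrices on the root group. -/
noncomputable def frobU (i0 i1 : Fin n) (h : i0 ≠ i1) (k : ℕ) : Matrix (Fin n) (Fin n) A :=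
  Matrix.of fun i j => ((F A[X] (frobElem i0 i1 h X)).1 i j).coeff k

lemma frobTau_map (i0 : Fin n) {G H : Type*} [AddCommGroup G] [AddCommGroup H] (φ : G →+ H)
    (g : G) (i j : Fin n) :
    AddMonoidAlgebra.mapDomainAlgHom A A φ ((frobTau i0 g).1 i j) = (frobTau i0 (φ g)).1 i j := by
  rw [frobTau_apply, frobTau_apply]
  split_ifs
  · rw [AddMonoidAlgebra.mapDomainAlgHom_apply, AddMonoidAlgebra.mapDomain_single, map_zsmul]
  · simp

lemma frobP_idem (hF : FrobNat F) (i0 : Fin n) (k : ℤ) :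
    frobP F i0 k * frobP F i0 k = frobP F i0 k := by
  ext i j
  have h1 := hF _ _ (AddMonoidAlgebra.mapDomainAlgHom A A (AddMonoidHom.inl ℤ ℤ))
    (frobTau i0 1) (frobTau i0 (1, 0)) (frobTau_map i0 _ 1)
  have h2 := hF _ _ (AddMonoidAlgebra.mapDomainAlgHom A A (AddMonoidHom.inr ℤ ℤ))
    (frobTau i0 1) (frobTau i0 (0, 1)) (frobTau_map i0 _ 1)
  have h3 := hF _ _ (AddMonoidAlgebra.mapDomainAlgHom A A
      ((AddMonoidHom.id ℤ).prod (AddMonoidHom.id ℤ)))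
    (frobTau i0 1) (frobTau i0 ((1, 0) + (0, 1))) (frobTau_map i0 _ 1)
  have h4 := h3 i j
  rw [← frobTau_mul, map_mul, frob_mul_apply] at h4
  have h5 := congrArg (fun f => f.coeff (k, k)) h4
  simp only [h1, h2] at h5
  rw [frob_coeff_diag, AddMonoidAlgebra.coeff_sum, Finsupp.finsetSum_apply] at h5
  simp only [frob_coeff_inl_inr] at h5
  rw [Matrix.mul_apply]
  exact h5

lemma frobU_mul (hF : FrobNat F) (i0 i1 : Fin n) (h : i0 ≠ i1) (r q : ℕ) :
    frobU F i0 i1 h r * frobU F i0 i1 h q = (Nat.choose (q + r) q : A) • frobU F i0 i1 h (q + r) := by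
  ext i j
  have hm : ∀ (f : A[X] →ₐ[A] A[X][X]) (i j : Fin n), f ((frobElem i0 i1 h X).1 i j)
      = (frobElem i0 i1 h (f X)).1 i j := by
    intro f i j
    rw [frobElem_apply, frobElem_apply, map_add, apply_ite f, apply_ite f, map_one, map_zero]
  have hX : ∀ f : A[X], aeval (C X : A[X][X]) f = C f := by
    intro f
    have : (aeval (C X : A[X][X])) = AlgHom.restrictScalars A (CAlgHom : A[X] →ₐ[A[X]] A[X][X]) := by
      ext; simp
    rw [this]; rfl
  have hY : ∀ f : A[X], aeval (X : A[X][X]) f = f.map C := by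
    intro f
    have := aeval_map_algebraMap A[X] (X : A[X][X]) f
    rw [← this, aeval_X_left_apply]; rfl
  have h1 := hF _ _ (aeval (C X : A[X][X])) (frobElem i0 i1 h X) _ (hm _)
  have h2 := hF _ _ (aeval (X : A[X][X])) (frobElem i0 i1 h X) _ (hm _)
  have h3 := hF _ _ (aeval (X + C X : A[X][X])) (frobElem i0 i1 h X) _ (hm _)
  have h4 := h3 i j
  simp only [aeval_X] at h1 h2 h4
  rw [add_comm, ← frobElem_mul, map_mul, frob_mul_apply] at h4
  have h5 := congrArg (fun f => (f.coeff q).coeff r) h4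
  simp only [h1, h2] at h5
  rw [add_comm (C X) X, frob_coeff_add, finsetSum_coeff, finsetSum_coeff] at h5
  simp only [hX, hY, coeff_C_mul, coeff_map, coeff_mul_C] at h5
  rw [Matrix.mul_apply, Matrix.smul_apply]
  exact h5

lemma frob_comm (hF : FrobNat F) (i0 i1 : Fin n) (h : i0 ≠ i1) (k : ℤ) (q : ℕ) :
    frobP F i0 k * frobU F i0 i1 h q = frobU F i0 i1 h q * frobP F i0 (k - q * n) := by
  let t : (AddMonoidAlgebra A ℤ) := AddMonoidAlgebra.single (n : ℤ) 1
  let φ : (AddMonoidAlgebra A ℤ) →ₐ[A] (AddMonoidAlgebra A ℤ)[X] := AlgHom.restrictScalars A (CAlgHom : (AddMonoidAlgebra A ℤ) →ₐ[(AddMonoidAlgebra A ℤ)] (AddMonoidAlgebra A ℤ)[X])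
  have hm : ∀ (f : A[X] →ₐ[A] (AddMonoidAlgebra A ℤ)[X]) (i j : Fin n), f ((frobElem i0 i1 h X).1 i j)
      = (frobElem i0 i1 h (f X)).1 i j := by
    intro f i j
    rw [frobElem_apply, frobElem_apply, map_add, apply_ite f, apply_ite f, map_one, map_zero]
  let T : SpecialLinearGroup (Fin n) (AddMonoidAlgebra A ℤ)[X] := SpecialLinearGroup.map (φ : (AddMonoidAlgebra A ℤ) →+* (AddMonoidAlgebra A ℤ)[X]) (frobTau i0 1)
  have hT : ∀ i j, (F (AddMonoidAlgebra A ℤ)[X] T).1 i j = C ((F (AddMonoidAlgebra A ℤ) (frobTau i0 1)).1 i j) :=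
    hF _ _ φ (frobTau i0 1) T (fun i j => rfl)
  have h1 := hF _ _ (aeval (C 1 * X : (AddMonoidAlgebra A ℤ)[X])) (frobElem i0 i1 h X) _ (hm _)
  have h2 := hF _ _ (aeval (C t * X : (AddMonoidAlgebra A ℤ)[X])) (frobElem i0 i1 h X) _ (hm _)
  have hT' : T.1 = Matrix.diagonal fun i => C (AddMonoidAlgebra.single (frobW i0 i • 1) 1 : (AddMonoidAlgebra A ℤ)) := by
    ext1 i j
    change C ((frobTau i0 1).1 i j) = _
    rw [frobTau_apply, Matrix.diagonal_apply]
    split_ifs <;> simp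
  have hrel : T * frobElem i0 i1 h (aeval (C 1 * X : (AddMonoidAlgebra A ℤ)[X]) (X : A[X]))
      = frobElem i0 i1 h (aeval (C t * X : (AddMonoidAlgebra A ℤ)[X]) (X : A[X])) * T := by
    apply Subtype.ext
    ext1 i j
    rw [frob_mul_val, frob_mul_val, hT', Matrix.diagonal_mul, Matrix.mul_diagonal]
    rw [frobElem_apply, frobElem_apply, aeval_X, aeval_X, mul_add, add_mul]
    congr 1
    · split_ifs with hij
      · rw [hij, mul_one, one_mul]
      · simp
    · split_ifs with hij
      · obtain ⟨rfl, rfl⟩ := hij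
        have : (AddMonoidAlgebra.single (frobW i0 i0 • 1) 1 : (AddMonoidAlgebra A ℤ))
            = t * AddMonoidAlgebra.single (frobW i0 i1 • 1) 1 := by
          rw [AddMonoidAlgebra.single_mul_single]
          simp only [frobW, if_true, if_neg h.symm, mul_one]
          congr 1
          simp; ring
        rw [this, C_mul, C_1]; ring
      · simp
  ext i j
  have h4 := congrArg (fun M => (F (AddMonoidAlgebra A ℤ)[X] M).1 i j) hrel
  simp only [map_mul, frob_mul_apply] at h4
  have h5 := congrArg (fun f => (f.coeff q).coeff k) h4
  simp only [h1, h2, hT, finsetSum_coeff, coeff_C_mul, coeff_mul_C, frob_coeff_scale,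
    AddMonoidAlgebra.coeff_sum, Finsupp.finsetSum_apply, one_pow, mul_one] at h5
  rw [Matrix.mul_apply, Matrix.mul_apply]
  have e1 : ∀ (x : (AddMonoidAlgebra A ℤ)) (a : A), (x * algebraMap A (AddMonoidAlgebra A ℤ) a).coeff k = x.coeff k * a := by
    intro x a
    rw [mul_comm, ← Algebra.smul_def, AddMonoidAlgebra.coeff_smul, Finsupp.smul_apply, smul_eq_mul,
      mul_comm]
  have e2 : ∀ (x : (AddMonoidAlgebra A ℤ)) (a : A), (algebraMap A (AddMonoidAlgebra A ℤ) a * t ^ q * x).coeff k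
      = a * x.coeff (k - q * n) := by
    intro x a
    rw [mul_assoc, ← Algebra.smul_def, AddMonoidAlgebra.coeff_smul, Finsupp.smul_apply, smul_eq_mul,
      AddMonoidAlgebra.single_pow]
    rw [AddMonoidAlgebra.coeff_single_mul_eq_mul_coeff (k - q * n), one_pow, one_mul]
    intro m' _
    rw [nsmul_eq_mul]
    constructor <;> intro h <;> linarith
  simp only [e1] at h5
  refine h5.trans (Finset.sum_congr rfl fun m _ => ?_)
  exact e2 _ _

end FrobMain


/-- Let `p` be a prime and `n ≥ 2`.  Let `A` be a nonzero Artinian local commutative ring with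
`p ≠ 0` in `A`, whose residue field `κ` is a perfect field of characteristic `p`.  Then there is
no natural family of group homomorphisms `F_B : SL_n(B) → SL_n(B)`, indexed by commutative
`A`-algebras `B`, restricting to the entrywise Frobenius on every `κ`-algebra `B` (i.e. every
`B` on which the structure map kills the maximal ideal of `A`): the Frobenius homomorphism of
`SL_n` admits no deformation over `A`. -/
theorem no_deformation_of_frobenius_SL
    (p n : ℕ) [Fact p.Prime] (hn : 2 ≤ n)
    (A : Type u) [CommRing A] [IsArtinianRing A] [IsLocalRing A] [Nontrivial A]
    (hpA : (p : A) ≠ 0)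
    [CharP (IsLocalRing.ResidueField A) p]
    [PerfectField (IsLocalRing.ResidueField A)] :
    ¬ ∃ F : ∀ (B : Type u) [CommRing B] [Algebra A B],
        SpecialLinearGroup (Fin n) B →* SpecialLinearGroup (Fin n) B,
      (∀ (B B' : Type u) [CommRing B] [CommRing B'] [Algebra A B] [Algebra A B']
          (f : B →ₐ[A] B') (M : SpecialLinearGroup (Fin n) B),
          F B' (SpecialLinearGroup.map (f : B →+* B') M)
            = SpecialLinearGroup.map (f : B →+* B') (F B M)) ∧
      (∀ (B : Type u) [CommRing B] [Algebra A B],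
          (∀ a ∈ IsLocalRing.maximalIdeal A, algebraMap A B a = 0) →
          ∀ (M : SpecialLinearGroup (Fin n) B) (i j : Fin n),
            (F B M : Matrix (Fin n) (Fin n) B) i j
              = ((M : Matrix (Fin n) (Fin n) B) i j) ^ p) := by
  rintro ⟨F, hnat, hfrob⟩
  have hp2 : 2 ≤ p := (Fact.out : p.Prime).two_le
  set i0 : Fin n := ⟨0, by omega⟩ with hi0
  set i1 : Fin n := ⟨1, by omega⟩ with hi1
  have h01 : i0 ≠ i1 := by simp [hi0, hi1]
  let κ := IsLocalRing.ResidueField A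
  have hmk : ∀ a ∈ IsLocalRing.maximalIdeal A, algebraMap A κ a = 0 := fun a ha =>
    (IsLocalRing.residue_eq_zero_iff a).2 ha
  have hkm : ∀ a, algebraMap A κ a = 0 → a ∈ IsLocalRing.maximalIdeal A := fun a ha =>
    (IsLocalRing.residue_eq_zero_iff a).1 ha
  have hF : FrobNat F := by
    intro B B' _ _ _ _ f M M' h i j
    have : M' = SpecialLinearGroup.map (f : B →+* B') M := by
      ext i j; exact (h i j).symm
    rw [this, hnat]; rfl
  -- reduction of the coefficient matrices
  have hPred : ∀ (k : ℤ) (i j : Fin n), algebraMap A κ (frobP F i0 k i j)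
      = if i = j ∧ p * frobW i0 i = k then 1 else 0 := by
    intro k i j
    have h1 := hF _ _ (AddMonoidAlgebra.mapAlgHom ℤ (Algebra.ofId A κ))
      (frobTau i0 1) (frobTau i0 1) (by
        intro i j
        rw [frobTau_apply, frobTau_apply]
        split_ifs
        · rw [AddMonoidAlgebra.mapAlgHom_single, map_one]
        · simp) i j
    have h2 := hfrob (AddMonoidAlgebra κ ℤ) (by
      intro a ha
      rw [IsScalarTower.algebraMap_apply A κ (AddMonoidAlgebra κ ℤ), hmk a ha, map_zero])
      (frobTau i0 1) i j
    have h3 := h1.symm.trans h2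
    have h4 := congrArg (fun f => f.coeff k) h3
    simp only [AddMonoidAlgebra.coeff_mapAlgHom] at h4
    refine h4.trans ?_
    change (((frobTau (A' := κ) i0 (1 : ℤ)).1 i j) ^ p).coeff k = _
    rw [frobTau_apply]
    by_cases hij : i = j
    · rw [if_pos hij, AddMonoidAlgebra.single_pow, AddMonoidAlgebra.coeff_single,
        Finsupp.single_apply]
      simp [hij]
    · rw [if_neg hij, zero_pow (by omega)]; simp [hij]
  have hUred : ∀ (i j : Fin n), algebraMap A κ (frobU F i0 i1 h01 p i j)
      = if i0 = i ∧ i1 = j then 1 else 0 := by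
    intro i j
    have h1 := hF _ _ (Polynomial.mapAlgHom (Algebra.ofId A κ))
      (frobElem i0 i1 h01 Polynomial.X) (frobElem i0 i1 h01 Polynomial.X) (by
        intro i j
        rw [frobElem_apply, frobElem_apply]
        split_ifs <;> simp) i j
    have h2 := hfrob (Polynomial κ) (by
      intro a ha
      rw [IsScalarTower.algebraMap_apply A κ (Polynomial κ), hmk a ha, map_zero])
      (frobElem i0 i1 h01 Polynomial.X) i j
    have h3 := h1.symm.trans h2
    have h4 := congrArg (fun f => f.coeff p) h3
    simp only [Polynomial.coe_mapAlgHom, Polynomial.coeff_map] at h4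
    refine h4.trans ?_
    change (((frobElem i0 i1 h01 (Polynomial.X : Polynomial κ)).1 i j) ^ p).coeff p = _
    rw [frobElem_apply]
    have hp0 : p ≠ 0 := by omega
    by_cases hij : i0 = i ∧ i1 = j
    · have : i ≠ j := by rw [← hij.1, ← hij.2]; exact h01
      rw [if_pos hij, if_neg this, if_pos hij]; simp
    · rw [if_neg hij, if_neg hij]
      split_ifs <;> simp [hp0, Polynomial.coeff_one]
  set a : ℤ := p * ((n : ℤ) - 1) with ha
  have hn' : (2 : ℤ) ≤ n := by exact_mod_cast hn
  have hp' : (2 : ℤ) ≤ p := by exact_mod_cast hp2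
  have hzero : frobP F i0 (a - (1 : ℕ) * n) = 0 := by
    apply frob_idem _ (frobP_idem F hF i0 _)
    intro i j
    apply hkm
    rw [hPred, if_neg]
    rintro ⟨-, h⟩
    unfold frobW at h
    rw [ha] at h
    push_cast at h
    split_ifs at h
    · omega
    · nlinarith
  have hPU : frobP F i0 a * frobU F i0 i1 h01 1 = 0 := by
    rw [frob_comm F hF, hzero, mul_zero]
  have hfin : (p : A) • (frobP F i0 a * frobU F i0 i1 h01 p) = 0 := by
    have := frobU_mul F hF i0 i1 h01 1 (p - 1)
    rw [Nat.sub_add_cancel (by omega : 1 ≤ p)] at this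
    have hc : Nat.choose p (p - 1) = p := by
      rw [Nat.choose_symm (by omega : 1 ≤ p), Nat.choose_one_right]
    rw [hc] at this
    rw [← Matrix.mul_smul, ← this, ← mul_assoc, hPU, zero_mul]
  have hent := congrFun (congrFun hfin i0) i1
  rw [Matrix.smul_apply, Matrix.zero_apply, smul_eq_mul] at hent
  have hunit : IsUnit ((frobP F i0 a * frobU F i0 i1 h01 p) i0 i1) := by
    by_contra hnu
    have := hmk _ ((IsLocalRing.mem_maximalIdeal _).2 hnu)
    rw [Matrix.mul_apply, map_sum] at this
    simp only [map_mul, hPred, hUred] at this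
    rw [Finset.sum_eq_single i0] at this
    · simp [frobW, ha] at this
    · intro b _ hb
      rw [if_neg (fun h => hb h.1.symm), zero_mul]
    · simp
  exact hpA (hunit.mul_left_eq_zero.1 hent)
end
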